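/- Let n ≥ 2, 1 < q < ∞, and suppose (θ1,θ2) ∈ [(A ∪ B) ∩ (C_q ∪ D_q)] ∪ {(θ1,θ2) : θ1 = 0, θ2 > −n}. Then there exists a constant C = C(n,q,θ1,θ2) > 0 such that for every R > 0, every pair of real numbers l > k, and every continuously differentiable function u : ℝ^n → ℝ, one has (l−k)^q · μ({x ∈ B_R(0) : u(x) ≥ l})^q · μ({x ∈ B_R(0) : u(x) ≤ k}) ≤ C R^{q(n+θ1+θ2+1)} ∫_{{x ∈ B_R(0) : k < u(x) < l}} |∇u|^q dμ, where dμ = |x'|^{θ1}|x|^{θ2} dx (weighted isoperimetric inequality of De Giorgi type, first form). -/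

import Mathlib

open MeasureTheory Metric Set
open scoped ENNReal NNReal Topology

noncomputable section

/-- `ℝ^n` as a Euclidean space. -/
abbrev En (n : ℕ) := EuclideanSpace ℝ (Fin n)

/-- `|x'|`: the Euclidean norm of the first `n-1` coordinates of `x`. -/
def normPrime (n : ℕ) (x : En n) : ℝ :=
  Real.sqrt (∑ i : Fin n, if (i : ℕ) + 1 < n then (x i) ^ 2 else 0)

/-- The anisotropic weight `w(x) = |x'|^θ1 * |x|^θ2`. -/
def weight (n : ℕ) (θ1 θ2 : ℝ) (x : En n) : ℝ :=
  normPrime n x ^ θ1 * ‖x‖ ^ θ2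

/-- The measure `dμ = w dx` on `ℝ^n`. -/
def muW (n : ℕ) (θ1 θ2 : ℝ) : Measure (En n) :=
  (volume : Measure (En n)).withDensity fun x => ENNReal.ofReal (weight n θ1 θ2 x)

/-- The index set `𝒜 = {(a,b) : a > -(n-1), b ≥ 0}`. -/
def setA (n : ℕ) : Set (ℝ × ℝ) := {p | -((n : ℝ) - 1) < p.1 ∧ 0 ≤ p.2}

/-- The index set `ℬ = {(a,b) : a > -(n-1), b < 0, a + b > -n}`. -/
def setB (n : ℕ) : Set (ℝ × ℝ) :=
  {p | -((n : ℝ) - 1) < p.1 ∧ p.2 < 0 ∧ -(n : ℝ) < p.1 + p.2}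

/-- The index set `𝒞_q = {(a,b) : a < (n-1)(q-1), b ≤ 0}`. -/
def setC (n : ℕ) (q : ℝ) : Set (ℝ × ℝ) := {p | p.1 < ((n : ℝ) - 1) * (q - 1) ∧ p.2 ≤ 0}

/-- The index set `𝒟_q = {(a,b) : a < (n-1)(q-1), b > 0, a+b < n(q-1)}`. -/
def setD (n : ℕ) (q : ℝ) : Set (ℝ × ℝ) :=
  {p | p.1 < ((n : ℝ) - 1) * (q - 1) ∧ 0 < p.2 ∧ p.1 + p.2 < (n : ℝ) * (q - 1)}

/-- The index set `ℱ = {(a,b) : a + b > -(n-1)}`. -/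
def setF (n : ℕ) : Set (ℝ × ℝ) := {p | -((n : ℝ) - 1) < p.1 + p.2}

/-- The integral of `g` along the segment from `x` to `z`, parametrised by `(0, 1)`. -/
def segInt {n : ℕ} (g : En n → ℝ≥0∞) (x z : En n) : ℝ≥0∞ :=
  ∫⁻ t in Ioo (0 : ℝ) 1, g (x + t • (z - x))

theorem measurable_segInt {n : ℕ} {g : En n → ℝ≥0∞} (hg : Measurable g) :
    Measurable fun p : En n × En n => segInt g p.1 p.2 := by
  unfold segInt
  refine Measurable.lintegral_prod_right' (f := fun p : (En n × En n) × ℝ =>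
    g (p.1.1 + p.2 • (p.1.2 - p.1.1))) ?_
  exact hg.comp (by fun_prop)

theorem lintegral_comp_smul_add {n : ℕ} {f : En n → ℝ≥0∞} (hf : Measurable f) (a : En n)
    {t : ℝ} (ht : 0 < t) :
    ∫⁻ z, f (a + t • z) = ENNReal.ofReal (t ^ n)⁻¹ * ∫⁻ z, f z := by
  have h1 : Measurable fun z => f (a + z) := hf.comp (by fun_prop)
  have h2 : Measurable fun z : En n => t • z := by fun_prop
  rw [← lintegral_map (f := fun z => f (a + z)) h1 h2,
    Measure.map_addHaar_smul volume ht.ne', lintegral_smul_measure,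
    lintegral_add_left_eq_self, finrank_euclideanSpace_fin, abs_of_pos (by positivity)]
  rfl

theorem setLIntegral_segment_le {n : ℕ} {f : En n → ℝ≥0∞} (hf : Measurable f) {R t : ℝ}
    (ht0 : 0 < t) (ht1 : t < 1) {x : En n} (hx : x ∈ ball (0 : En n) R) :
    ∫⁻ z in ball (0 : En n) R, f (x + t • (z - x)) ≤
      ENNReal.ofReal (t ^ n)⁻¹ * ∫⁻ y in ball (0 : En n) R ∩ ball x (2 * R * t), f y := by
  set S := ball (0 : En n) R ∩ ball x (2 * R * t) with hS
  have hSm : MeasurableSet S := measurableSet_ball.inter measurableSet_ball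
  rw [← lintegral_indicator hSm, ← lintegral_comp_smul_add (hf.indicator hSm) (x - t • x) ht0,
    ← lintegral_indicator measurableSet_ball]
  refine lintegral_mono fun z => ?_
  by_cases hz : z ∈ ball (0 : En n) R
  · have e : x - t • x + t • z = x + t • (z - x) := by rw [smul_sub]; abel
    have hmem : x + t • (z - x) ∈ S := by
      refine ⟨?_, ?_⟩
      · exact (convex_ball (0 : En n) R).add_smul_sub_mem hx hz ⟨ht0.le, ht1.le⟩
      · rw [mem_ball, dist_eq_norm, add_sub_cancel_left, norm_smul, Real.norm_of_nonneg ht0.le,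
          mul_comm]
        rw [mem_ball_zero_iff] at hx hz
        have := norm_sub_le z x
        gcongr
        linarith
    rw [e, indicator_of_mem hz, indicator_of_mem hmem]
  · rw [indicator_of_notMem hz]; exact zero_le

theorem lintegral_segInt_rpow_le {n : ℕ} {q R : ℝ} (hq : 1 < q)
    {w φ ψ : En n → ℝ≥0∞} (hφ : Measurable φ) {H : En n → Set (En n)}
    (hφ0 : ∀ x, φ x ≠ 0) (hφt : ∀ᵐ x, φ x ≠ ⊤)
    (hw : ∀ᵐ x, w x * φ x ^ (q - 1) = ψ x) {C₁ C₂ : ℝ≥0∞}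
    (hC₁ : C₁ ≠ ⊤) (hI : ∀ x ∈ ball (0 : En n) R, ∫⁻ z in H x, segInt φ x z ≤ C₁ * φ x)
    (hII : ∀ f : En n → ℝ≥0∞, Measurable f →
      ∫⁻ x in ball (0 : En n) R, ψ x * ∫⁻ z in H x, segInt f x z ≤
        C₂ * ∫⁻ x in ball (0 : En n) R, ψ x * f x)
    {g : En n → ℝ≥0∞} (hg : Measurable g) :
    ∫⁻ x in ball (0 : En n) R, w x * (∫⁻ z in H x, segInt g x z) ^ q ≤
      C₁ ^ (q - 1) * C₂ * ∫⁻ x in ball (0 : En n) R, w x * g x ^ q := by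
  classical
  have hq0 : 0 < q := by linarith
  have hq1 : 0 < q - 1 := by linarith
  have hconj : q.HolderConjugate (q / (q - 1)) := Real.HolderConjugate.conjExponent hq
  set f : En n → ℝ≥0∞ := fun x => if φ x = ⊤ then ⊤ else g x ^ q * (φ x ^ (q - 1))⁻¹ with hf
  have hfm : Measurable f := Measurable.ite (hφ (measurableSet_singleton ⊤)) measurable_const
    ((hg.pow_const q).mul (hφ.pow_const (q - 1)).inv)
  have hgf : ∀ x, g x ≤ f x ^ (1 / q) * φ x ^ ((q - 1) / q) := by
    intro x
    by_cases hx : φ x = ⊤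
    · simp [hf, hx, ENNReal.top_rpow_of_pos, hq0, div_pos hq1 hq0]
    · simp only [hf, hx, if_false]
      rw [show (q - 1) / q = (q - 1) * (1 / q) by ring, ENNReal.rpow_mul (φ x),
        ← ENNReal.mul_rpow_of_nonneg _ _ (by positivity), mul_assoc, ENNReal.inv_mul_cancel,
        mul_one, ← ENNReal.rpow_mul, mul_one_div_cancel hq0.ne', ENNReal.rpow_one]
      · simp [hφ0 x, hx]
      · exact ENNReal.rpow_ne_top_of_nonneg hq1.le hx
  have hpt : ∀ x ∈ ball (0 : En n) R, (∫⁻ z in H x, segInt g x z) ^ q ≤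
      (C₁ * φ x) ^ (q - 1) * ∫⁻ z in H x, segInt f x z := by
    intro x hx
    have hm : Measurable fun p : En n × ℝ => x + p.2 • (p.1 - x) := by fun_prop
    have hseg : ∀ h : En n → ℝ≥0∞, Measurable h → ∫⁻ z in H x, segInt h x z =
        ∫⁻ p, h (x + p.2 • (p.1 - x)) ∂((volume.restrict (H x)).prod
          (volume.restrict (Ioo (0 : ℝ) 1))) := by
      intro h hh
      exact (lintegral_prod _ (hh.comp hm).aemeasurable).symm
    have h1 : ∫⁻ z in H x, segInt g x z ≤
        (∫⁻ z in H x, segInt f x z) ^ (1 / q) *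
          (∫⁻ z in H x, segInt φ x z) ^ ((q - 1) / q) := by
      rw [hseg g hg, hseg f hfm, hseg φ hφ]
      have := ENNReal.lintegral_mul_le_Lp_mul_Lq ((volume.restrict (H x)).prod
          (volume.restrict (Ioo (0 : ℝ) 1))) hconj
          (f := fun p => f (x + p.2 • (p.1 - x)) ^ (1 / q))
          (g := fun p => φ (x + p.2 • (p.1 - x)) ^ ((q - 1) / q))
          ((hfm.comp hm).pow_const _).aemeasurable ((hφ.comp hm).pow_const _).aemeasurable
      simp only [← ENNReal.rpow_mul, one_div_mul_cancel hq0.ne', ENNReal.rpow_one,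
        show (q - 1) / q * (q / (q - 1)) = 1 by field_simp, one_div_div] at this
      exact (lintegral_mono fun p => hgf _).trans this
    calc (∫⁻ z in H x, segInt g x z) ^ q
        ≤ ((∫⁻ z in H x, segInt f x z) ^ (1 / q) *
          (∫⁻ z in H x, segInt φ x z) ^ ((q - 1) / q)) ^ q := by gcongr
      _ = (∫⁻ z in H x, segInt φ x z) ^ (q - 1) * ∫⁻ z in H x, segInt f x z := by
          rw [ENNReal.mul_rpow_of_nonneg _ _ hq0.le, ← ENNReal.rpow_mul, ← ENNReal.rpow_mul,
            one_div_mul_cancel hq0.ne', ENNReal.rpow_one, div_mul_cancel₀ _ hq0.ne', mul_comm]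
      _ ≤ _ := by
          gcongr
          exact hI x hx
  calc ∫⁻ x in ball (0 : En n) R, w x * (∫⁻ z in H x, segInt g x z) ^ q
      ≤ ∫⁻ x in ball (0 : En n) R, C₁ ^ (q - 1) * (ψ x * ∫⁻ z in H x, segInt f x z) := by
        refine setLIntegral_mono_ae' measurableSet_ball ?_
        filter_upwards [hw] with x hx hxB
        rw [← hx]
        calc w x * (∫⁻ z in H x, segInt g x z) ^ q
            ≤ w x * ((C₁ * φ x) ^ (q - 1) * ∫⁻ z in H x, segInt f x z) := by
              gcongr; exact hpt x hxB
          _ = _ := by rw [ENNReal.mul_rpow_of_nonneg _ _ hq1.le]; ring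
    _ = C₁ ^ (q - 1) * ∫⁻ x in ball (0 : En n) R, ψ x * ∫⁻ z in H x, segInt f x z :=
        lintegral_const_mul' _ _ (ENNReal.rpow_ne_top_of_nonneg hq1.le hC₁)
    _ ≤ C₁ ^ (q - 1) * (C₂ * ∫⁻ x in ball (0 : En n) R, ψ x * f x) := by
        gcongr; exact hII f hfm
    _ = C₁ ^ (q - 1) * C₂ * ∫⁻ x in ball (0 : En n) R, w x * g x ^ q := by
        rw [mul_assoc]
        congr 2
        refine lintegral_congr_ae (ae_restrict_of_ae ?_)
        filter_upwards [hw, hφt] with x hx hxt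
        simp only [hf, hxt, if_false]
        rw [← hx, mul_comm (g x ^ q), mul_assoc, ← mul_assoc (φ x ^ (q - 1)),
          ENNReal.mul_inv_cancel, one_mul]
        · simp [hφ0 x, hxt]
        · exact ENNReal.rpow_ne_top_of_nonneg hq1.le hxt

theorem exists_smooth_truncation {k l : ℝ} (hkl : k < l) :
    ∃ T τ : ℝ → ℝ, (∀ s, HasDerivAt T (τ s) s) ∧ Continuous τ ∧ (∀ s, |τ s| ≤ 1) ∧
      (∀ s, s ∉ Ioo k l → τ s = 0) ∧ ∀ s r, s ≤ k → l ≤ r → (l - k) / 2 ≤ T r - T s := by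
  have hd : 0 < l - k := sub_pos.2 hkl
  set τ : ℝ → ℝ := fun s => max 0 (4 * ((s - k) * (l - s)) / (l - k) ^ 2) with hτ
  have hc : Continuous τ := by fun_prop
  have hi : ∀ a b, IntervalIntegrable τ volume a b := fun a b => hc.intervalIntegrable a b
  refine ⟨fun s => ∫ y in k..s, τ y, τ, fun s => hc.integral_hasStrictDerivAt k s |>.hasDerivAt,
    hc, fun s => ?_, fun s hs => ?_, fun s r hs hr => ?_⟩
  · rw [abs_of_nonneg (le_max_left _ _)]
    refine max_le zero_le_one ?_
    rw [div_le_one (by positivity)]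
    nlinarith [sq_nonneg (s - k - (l - s))]
  · refine max_eq_left (div_nonpos_of_nonpos_of_nonneg ?_ (by positivity))
    rw [mem_Ioo, not_and_or, not_lt, not_lt] at hs
    rcases hs with hs | hs
    · nlinarith [mul_nonneg (sub_nonneg.2 hs) (sub_nonneg.2 (hs.trans hkl.le))]
    · nlinarith [mul_nonneg (sub_nonneg.2 hs) (sub_nonneg.2 (hkl.le.trans hs))]
  · simp only
    rw [intervalIntegral.integral_interval_sub_left (hi _ _) (hi _ _)]
    have hmono : ∫ y in k..l, τ y ≤ ∫ y in s..r, τ y :=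
      intervalIntegral.integral_mono_interval hs hkl.le hr
        (Filter.Eventually.of_forall fun y => le_max_left _ _) (hi _ _)
    refine le_trans ?_ hmono
    have hpoly : ∫ y in k..l, τ y = ∫ y in k..l, 4 / (l - k) ^ 2 * ((y - k) * (l - y)) := by
      refine intervalIntegral.integral_congr fun y hy => ?_
      rw [uIcc_of_le hkl.le] at hy
      have : 0 ≤ (y - k) * (l - y) := mul_nonneg (by linarith [hy.1]) (by linarith [hy.2])
      simp only [hτ]
      rw [max_eq_right (by positivity)]
      ring
    have hval : ∫ y in k..l, (y - k) * (l - y) = (l - k) ^ 3 / 6 := by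
      have hder : ∀ y ∈ uIcc k l,
          HasDerivAt (fun y => (l - k) * (y - k) ^ 2 / 2 - (y - k) ^ 3 / 3)
            ((y - k) * (l - y)) y := by
        intro y _
        have h0 : HasDerivAt (fun y : ℝ => y - k) 1 y := (hasDerivAt_id y).sub_const k
        refine ((((h0.pow 2).const_mul (l - k)).div_const 2).sub
          ((h0.pow 3).div_const 3)).congr_deriv ?_
        norm_num
        ring
      rw [intervalIntegral.integral_eq_sub_of_hasDerivAt hder
        (Continuous.intervalIntegrable (by fun_prop) _ _)]
      ring
    rw [hpoly, intervalIntegral.integral_const_mul, hval,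
      show 4 / (l - k) ^ 2 * ((l - k) ^ 3 / 6) = 2 / 3 * (l - k) by field_simp; ring]
    linarith

theorem measurable_truncated_gradient {n : ℕ} {u : En n → ℝ} (hu : ContDiff ℝ 1 u) (k l : ℝ) :
    Measurable ((u ⁻¹' Ioo k l).indicator fun x => ‖gradient u x‖ₑ) := by
  refine Measurable.indicator ?_ (hu.continuous.measurable measurableSet_Ioo)
  have : Continuous fun x => gradient u x :=
    (InnerProductSpace.toDual ℝ (En n)).symm.continuous.comp (hu.continuous_fderiv one_ne_zero)
  exact this.measurable.enorm

theorem exists_truncation_segInt_bound {n : ℕ} {u : En n → ℝ} (hu : ContDiff ℝ 1 u) {k l : ℝ}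
    (hkl : k < l) :
    ∃ v : En n → ℝ, (∀ x z, ‖v z - v x‖ₑ ≤ ‖z - x‖ₑ *
        segInt ((u ⁻¹' Ioo k l).indicator fun x => ‖gradient u x‖ₑ) x z) ∧
      ∀ x y, l ≤ u x → u y ≤ k → ENNReal.ofReal ((l - k) / 2) ≤ ‖v x - v y‖ₑ := by
  obtain ⟨T, τ, hT, hτc, hτ1, hτ0, hTd⟩ := exists_smooth_truncation hkl
  set g : En n → ℝ≥0∞ := (u ⁻¹' Ioo k l).indicator fun x => ‖gradient u x‖ₑ with hg
  refine ⟨T ∘ u, fun x z => ?_, fun x y hx hy => ?_⟩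
  · have hline : ∀ t : ℝ, HasDerivAt (fun t : ℝ => T (u (x + t • (z - x))))
        (τ (u (x + t • (z - x))) * fderiv ℝ u (x + t • (z - x)) (z - x)) t := by
      intro t
      have h1 : HasDerivAt (fun t : ℝ => x + t • (z - x)) (z - x) t := by
        simpa using ((hasDerivAt_id t).smul_const (z - x)).const_add x
      have h2 := ((hu.differentiable one_ne_zero).differentiableAt
        (x := x + t • (z - x))).hasFDerivAt
      exact (hT _).comp t (h2.comp_hasDerivAt t h1)
    have hcont : Continuous fun t : ℝ =>
        τ (u (x + t • (z - x))) * fderiv ℝ u (x + t • (z - x)) (z - x) := by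
      have hl : Continuous fun t : ℝ => x + t • (z - x) := by fun_prop
      exact (hτc.comp (hu.continuous.comp hl)).mul
        (((hu.continuous_fderiv one_ne_zero).comp hl).clm_apply continuous_const)
    have hint := intervalIntegral.integral_eq_sub_of_hasDerivAt (a := 0) (b := 1)
      (fun t _ => hline t) (hcont.intervalIntegrable _ _)
    simp only [one_smul, zero_smul, add_zero, add_sub_cancel] at hint
    rw [Function.comp_apply, Function.comp_apply, ← hint,
      intervalIntegral.integral_of_le zero_le_one, integral_Ioc_eq_integral_Ioo]
    refine (enorm_integral_le_lintegral_enorm _).trans ?_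
    rw [segInt, ← lintegral_const_mul' _ _ enorm_ne_top]
    refine lintegral_mono fun t => ?_
    by_cases ht : u (x + t • (z - x)) ∈ Ioo k l
    · have hgt : g (x + t • (z - x)) = ‖fderiv ℝ u (x + t • (z - x))‖ₑ := by
        rw [hg, indicator_of_mem (by exact ht), gradient, ← ofReal_norm, ← ofReal_norm,
          LinearIsometryEquiv.norm_map]
      rw [hgt, ← ofReal_norm, ← ofReal_norm, ← ofReal_norm,
        ← ENNReal.ofReal_mul (norm_nonneg _)]
      refine ENNReal.ofReal_le_ofReal ?_
      rw [norm_mul]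
      calc ‖τ (u (x + t • (z - x)))‖ * ‖fderiv ℝ u (x + t • (z - x)) (z - x)‖
          ≤ 1 * (‖fderiv ℝ u (x + t • (z - x))‖ * ‖z - x‖) :=
            mul_le_mul (hτ1 _) (ContinuousLinearMap.le_opNorm _ _) (norm_nonneg _) zero_le_one
        _ = _ := by ring
    · rw [hτ0 _ ht]; simp
  · rw [← ofReal_norm]
    exact ENNReal.ofReal_le_ofReal ((hTd _ _ hy hx).trans (le_abs_self _))

theorem setLIntegral_segInt_dichotomy {n : ℕ} {R : ℝ} {H : En n → Set (En n)}
    (hH : ∀ x, H x ⊆ ball (0 : En n) R) (hHm : ∀ x, MeasurableSet (H x)) {m : ℝ≥0∞}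
    (hm : ∀ x ∈ ball (0 : En n) R, ∀ y ∈ ball (0 : En n) R, m ≤ volume (H x ∩ H y))
    {u : En n → ℝ} (hu : ContDiff ℝ 1 u) {k l : ℝ} (hkl : k < l) {x y : En n}
    (hx : x ∈ ball (0 : En n) R) (hy : y ∈ ball (0 : En n) R) (hux : l ≤ u x) (huy : u y ≤ k)
    {g : En n → ℝ≥0∞} (hg : g = (u ⁻¹' Ioo k l).indicator fun x => ‖gradient u x‖ₑ) :
    ENNReal.ofReal ((l - k) / 2) * m ≤ ENNReal.ofReal (2 * R) *
      ((∫⁻ z in H x, segInt g x z) + ∫⁻ z in H y, segInt g y z) := by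
  obtain ⟨v, hv, hvd⟩ := exists_truncation_segInt_bound hu hkl
  rw [← hg] at hv
  have hgm : Measurable g := hg ▸ measurable_truncated_gradient hu k l
  have hsm : ∀ x, Measurable fun z => segInt g x z := fun x =>
    (measurable_segInt hgm).comp measurable_prodMk_left
  have hb : ∀ x ∈ ball (0 : En n) R, ∀ z ∈ ball (0 : En n) R,
      ‖v z - v x‖ₑ ≤ ENNReal.ofReal (2 * R) * segInt g x z := by
    intro x hx z hz
    refine (hv x z).trans ?_
    gcongr
    rw [← ofReal_norm]
    rw [mem_ball_zero_iff] at hx hz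
    exact ENNReal.ofReal_le_ofReal (by linarith [norm_sub_le z x])
  calc ENNReal.ofReal ((l - k) / 2) * m
      ≤ ENNReal.ofReal ((l - k) / 2) * volume (H x ∩ H y) := by gcongr; exact hm x hx y hy
    _ = ∫⁻ z in H x ∩ H y, ENNReal.ofReal ((l - k) / 2) := by rw [setLIntegral_const]
    _ ≤ ∫⁻ z in H x ∩ H y, ENNReal.ofReal (2 * R) * (segInt g x z + segInt g y z) := by
        refine setLIntegral_mono' ((hHm x).inter (hHm y)) fun z hz => ?_
        refine (hvd x y hux huy).trans ?_
        calc ‖v x - v y‖ₑ = ‖-(v z - v x) + (v z - v y)‖ₑ := by congr 1; ring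
          _ ≤ ‖-(v z - v x)‖ₑ + ‖v z - v y‖ₑ := enorm_add_le _ _
          _ ≤ _ := by
            rw [enorm_neg, mul_add]
            exact add_le_add (hb x hx z (hH x hz.1)) (hb y hy z (hH x hz.1))
    _ = ENNReal.ofReal (2 * R) * ((∫⁻ z in H x ∩ H y, segInt g x z) +
          ∫⁻ z in H x ∩ H y, segInt g y z) := by
        rw [lintegral_const_mul' _ _ ENNReal.ofReal_ne_top, lintegral_add_left (hsm x)]
    _ ≤ _ := by
        gcongr
        · exact inter_subset_left
        · exact inter_subset_right

theorem isoperimetric_of_schur {n : ℕ} {q R : ℝ} (hq : 1 < q) (hR : 0 < R)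
    {w φ ψ : En n → ℝ≥0∞} (hwm : Measurable w) (hφ : Measurable φ) {H : En n → Set (En n)}
    (hH : ∀ x, H x ⊆ ball (0 : En n) R) (hHm : ∀ x, MeasurableSet (H x))
    (hφ0 : ∀ x, φ x ≠ 0) (hφt : ∀ᵐ x, φ x ≠ ⊤)
    (hw : ∀ᵐ x, w x * φ x ^ (q - 1) = ψ x) {c₁ c₂ c₃ : ℝ} (hc₁ : 0 < c₁)
    (hc₃ : 0 < c₃)
    (hI : ∀ x ∈ ball (0 : En n) R, ∫⁻ z in H x, segInt φ x z ≤ ENNReal.ofReal c₁ * φ x)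
    (hII : ∀ f : En n → ℝ≥0∞, Measurable f →
      ∫⁻ x in ball (0 : En n) R, ψ x * ∫⁻ z in H x, segInt f x z ≤
        ENNReal.ofReal c₂ * ∫⁻ x in ball (0 : En n) R, ψ x * f x)
    (hm : ∀ x ∈ ball (0 : En n) R, ∀ y ∈ ball (0 : En n) R,
      ENNReal.ofReal c₃ ≤ volume (H x ∩ H y))
    {M : ℝ} (hM0 : 0 < M)
    (hM : volume.withDensity w (ball (0 : En n) R) ≤ ENNReal.ofReal M)
    {u : En n → ℝ} (hu : ContDiff ℝ 1 u) {k l : ℝ} (hkl : k < l) :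
    ENNReal.ofReal ((l - k) ^ q) *
        (volume.withDensity w {x ∈ ball (0 : En n) R | l ≤ u x}) ^ q *
        volume.withDensity w {x ∈ ball (0 : En n) R | u x ≤ k} ≤
      ENNReal.ofReal (M ^ q * (8 * R / c₃) ^ q * c₁ ^ (q - 1) * c₂) *
        ∫⁻ x in {x ∈ ball (0 : En n) R | k < u x ∧ u x < l},
          ENNReal.ofReal (‖gradient u x‖ ^ q) ∂(volume.withDensity w) := by
  have hq0 : 0 < q := by linarith
  have hq1 : 0 < q - 1 := by linarith
  set μ := volume.withDensity w with hμ
  set B := ball (0 : En n) R with hB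
  set A := {x ∈ B | l ≤ u x} with hA
  set D := {x ∈ B | u x ≤ k} with hD
  set g : En n → ℝ≥0∞ := (u ⁻¹' Ioo k l).indicator fun x => ‖gradient u x‖ₑ with hg
  have hgm : Measurable g := measurable_truncated_gradient hu k l
  set F : En n → ℝ≥0∞ := fun x => ∫⁻ z in H x, segInt g x z with hF
  have hAm : MeasurableSet A := measurableSet_ball.inter
    (hu.continuous.measurable measurableSet_Ici)
  have hDm : MeasurableSet D := measurableSet_ball.inter
    (hu.continuous.measurable measurableSet_Iic)
  have hUm : MeasurableSet (u ⁻¹' Ioo k l) := hu.continuous.measurable measurableSet_Ioo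
  have hgint : ∫⁻ x in {x ∈ B | k < u x ∧ u x < l}, ENNReal.ofReal (‖gradient u x‖ ^ q) ∂μ =
      ∫⁻ x in B, g x ^ q ∂μ := by
    have hgq : (fun x => g x ^ q) =
        (u ⁻¹' Ioo k l).indicator fun x => ENNReal.ofReal (‖gradient u x‖ ^ q) := by
      ext x
      by_cases hx : x ∈ u ⁻¹' Ioo k l
      · rw [hg, indicator_of_mem hx, indicator_of_mem hx, ← ofReal_norm,
          ENNReal.ofReal_rpow_of_nonneg (norm_nonneg _) hq0.le]
      · rw [hg, indicator_of_notMem hx, indicator_of_notMem hx, ENNReal.zero_rpow_of_pos hq0]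
    rw [hgq, lintegral_indicator hUm, Measure.restrict_restrict hUm, inter_comm]
    rfl
  have hFint : ∫⁻ x in B, F x ^ q ∂μ ≤
      ENNReal.ofReal (c₁ ^ (q - 1) * c₂) * ∫⁻ x in B, g x ^ q ∂μ := by
    rw [hμ, restrict_withDensity measurableSet_ball,
      lintegral_withDensity_eq_lintegral_mul _ hwm (hgm.pow_const q),
      ENNReal.ofReal_mul (by positivity), ← ENNReal.ofReal_rpow_of_nonneg hc₁.le hq1.le]
    refine (lintegral_withDensity_le_lintegral_mul _ hwm _).trans ?_
    exact lintegral_segInt_rpow_le hq hφ hφ0 hφt hw ENNReal.ofReal_ne_top hI hII hgm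
  set L := ENNReal.ofReal ((l - k) / 2) with hL
  have hkey : ∀ S ⊆ B, MeasurableSet S →
      (∀ x ∈ S, L * ENNReal.ofReal c₃ ≤ ENNReal.ofReal (4 * R) * F x) →
      ENNReal.ofReal ((l - k) ^ q) * μ S ≤
        ENNReal.ofReal ((8 * R / c₃) ^ q * c₁ ^ (q - 1) * c₂) * ∫⁻ x in B, g x ^ q ∂μ := by
    intro S hSB hSm hS
    have hpt : ∀ x ∈ S, ENNReal.ofReal ((l - k) ^ q) ≤
        ENNReal.ofReal ((8 * R / c₃) ^ q) * F x ^ q := by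
      intro x hx
      have hlk : 0 < l - k := sub_pos.2 hkl
      rw [← ENNReal.ofReal_rpow_of_nonneg hlk.le hq0.le,
        ← ENNReal.ofReal_rpow_of_nonneg (by positivity) hq0.le,
        ← ENNReal.mul_rpow_of_nonneg _ _ hq0.le]
      refine ENNReal.rpow_le_rpow ?_ hq0.le
      have h2 : ENNReal.ofReal (l - k) =
          L * ENNReal.ofReal c₃ * ENNReal.ofReal (2 / c₃) := by
        rw [hL, ← ENNReal.ofReal_mul (by positivity), ← ENNReal.ofReal_mul (by positivity)]
        congr 1
        field_simp
      have h3 : ENNReal.ofReal (8 * R / c₃) =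
          ENNReal.ofReal (4 * R) * ENNReal.ofReal (2 / c₃) := by
        rw [← ENNReal.ofReal_mul (by positivity)]
        congr 1
        ring
      rw [h2, h3, mul_right_comm (ENNReal.ofReal (4 * R))]
      exact mul_le_mul_left (hS x hx) _
    calc ENNReal.ofReal ((l - k) ^ q) * μ S = ∫⁻ x in S, ENNReal.ofReal ((l - k) ^ q) ∂μ := by
          rw [setLIntegral_const]
      _ ≤ ∫⁻ x in S, ENNReal.ofReal ((8 * R / c₃) ^ q) * F x ^ q ∂μ :=
          setLIntegral_mono' hSm hpt
      _ = ENNReal.ofReal ((8 * R / c₃) ^ q) * ∫⁻ x in S, F x ^ q ∂μ :=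
          lintegral_const_mul' _ _ ENNReal.ofReal_ne_top
      _ ≤ ENNReal.ofReal ((8 * R / c₃) ^ q) * ∫⁻ x in B, F x ^ q ∂μ := by gcongr
      _ ≤ ENNReal.ofReal ((8 * R / c₃) ^ q) *
          (ENNReal.ofReal (c₁ ^ (q - 1) * c₂) * ∫⁻ x in B, g x ^ q ∂μ) := by gcongr
      _ = _ := by
          rw [← mul_assoc, ← ENNReal.ofReal_mul (by positivity)]
          congr 2
          ring
  have hsplit : (∀ x ∈ A, L * ENNReal.ofReal c₃ ≤ ENNReal.ofReal (4 * R) * F x) ∨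
      ∀ x ∈ D, L * ENNReal.ofReal c₃ ≤ ENNReal.ofReal (4 * R) * F x := by
    by_contra! hcon
    obtain ⟨⟨x, hxA, hx⟩, ⟨y, hyD, hy⟩⟩ := hcon
    have h := setLIntegral_segInt_dichotomy hH hHm hm hu hkl hxA.1 hyD.1 hxA.2 hyD.2 hg
    have h4 : ENNReal.ofReal (4 * R) = 2 * ENNReal.ofReal (2 * R) := by
      rw [← ENNReal.ofReal_ofNat 2, ← ENNReal.ofReal_mul (by norm_num)]
      congr 1
      ring
    have hlt := ENNReal.add_lt_add hx hy
    rw [← mul_add, h4, mul_assoc, ← two_mul] at hlt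
    exact absurd (mul_le_mul_right h 2) (not_le.2 hlt)
  have hAB : μ A ≤ ENNReal.ofReal M := (measure_mono fun x hx => hx.1).trans hM
  have hDB : μ D ≤ ENNReal.ofReal M := (measure_mono fun x hx => hx.1).trans hM
  have hfin : ∀ S, ENNReal.ofReal ((l - k) ^ q) * μ S ≤
        ENNReal.ofReal ((8 * R / c₃) ^ q * c₁ ^ (q - 1) * c₂) * ∫⁻ x in B, g x ^ q ∂μ →
      μ A ^ q * μ D ≤ ENNReal.ofReal M ^ q * μ S →
      ENNReal.ofReal ((l - k) ^ q) * μ A ^ q * μ D ≤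
        ENNReal.ofReal (M ^ q * (8 * R / c₃) ^ q * c₁ ^ (q - 1) * c₂) *
          ∫⁻ x in B, g x ^ q ∂μ := by
    intro S h1 h2
    calc ENNReal.ofReal ((l - k) ^ q) * μ A ^ q * μ D
        ≤ ENNReal.ofReal ((l - k) ^ q) * (ENNReal.ofReal M ^ q * μ S) := by
          rw [mul_assoc]; gcongr
      _ = ENNReal.ofReal M ^ q * (ENNReal.ofReal ((l - k) ^ q) * μ S) := by ring
      _ ≤ ENNReal.ofReal M ^ q * (ENNReal.ofReal ((8 * R / c₃) ^ q * c₁ ^ (q - 1) * c₂) *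
          ∫⁻ x in B, g x ^ q ∂μ) := by gcongr
      _ = _ := by
          rw [ENNReal.ofReal_rpow_of_nonneg hM0.le hq0.le, ← mul_assoc,
            ← ENNReal.ofReal_mul (by positivity)]
          congr 2
          ring
  rw [hgint]
  rcases hsplit with h | h
  · refine hfin A (hkey A (fun x hx => hx.1) hAm h) ?_
    calc μ A ^ q * μ D = μ A ^ (1 + (q - 1)) * μ D := by ring_nf
      _ = μ A * μ A ^ (q - 1) * μ D := by
        rw [ENNReal.rpow_add_of_nonneg _ _ zero_le_one hq1.le, ENNReal.rpow_one]
      _ ≤ μ A * ENNReal.ofReal M ^ (q - 1) * ENNReal.ofReal M := by gcongr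
      _ = ENNReal.ofReal M ^ (1 + (q - 1)) * μ A := by
        rw [ENNReal.rpow_add_of_nonneg _ _ zero_le_one hq1.le, ENNReal.rpow_one]
        ring
      _ = _ := by ring_nf
  · refine hfin D (hkey D (fun x hx => hx.1) hDm h) ?_
    gcongr

/-- The coordinate projection `x ↦ (x', 0)`. -/
def projPrime (n : ℕ) : En n →ₗ[ℝ] En n where
  toFun x := WithLp.toLp 2 fun i => if (i : ℕ) + 1 < n then x i else 0
  map_add' x y := by
    ext i
    by_cases h : (i : ℕ) + 1 < n <;> simp [h]
  map_smul' c x := by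
    ext i
    by_cases h : (i : ℕ) + 1 < n <;> simp [h]

theorem projPrime_apply {n : ℕ} (x : En n) (i : Fin n) :
    projPrime n x i = if (i : ℕ) + 1 < n then x i else 0 := rfl

theorem normPrime_eq_norm {n : ℕ} (x : En n) : normPrime n x = ‖projPrime n x‖ := by
  rw [normPrime, EuclideanSpace.norm_eq]
  congr 1
  refine Finset.sum_congr rfl fun i _ => ?_
  rw [projPrime_apply]
  split_ifs <;> simp

theorem normPrime_nonneg {n : ℕ} (x : En n) : 0 ≤ normPrime n x := Real.sqrt_nonneg _

theorem normPrime_le_norm {n : ℕ} (x : En n) : normPrime n x ≤ ‖x‖ := by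
  rw [normPrime, EuclideanSpace.norm_eq]
  refine Real.sqrt_le_sqrt (Finset.sum_le_sum fun i _ => ?_)
  split_ifs <;> simp [sq_nonneg]

theorem abs_coord_le_normPrime {n : ℕ} (x : En n) {i : Fin n} (hi : (i : ℕ) + 1 < n) :
    |x i| ≤ normPrime n x := by
  have := PiLp.norm_apply_le (projPrime n x) i
  rw [projPrime_apply, if_pos hi, ← normPrime_eq_norm] at this
  exact this

theorem normPrime_le_add {n : ℕ} (x y : En n) :
    normPrime n x ≤ normPrime n y + dist y x := by
  have h : projPrime n x = projPrime n y + projPrime n (x - y) := by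
    rw [← map_add, add_sub_cancel]
  rw [normPrime_eq_norm x, h, dist_comm, dist_eq_norm]
  refine (norm_add_le _ _).trans ?_
  rw [← normPrime_eq_norm, ← normPrime_eq_norm]
  gcongr
  exact normPrime_le_norm _

theorem normPrime_smul {n : ℕ} {t : ℝ} (ht : 0 ≤ t) (x : En n) :
    normPrime n (t • x) = t * normPrime n x := by
  rw [normPrime_eq_norm, map_smul, norm_smul, Real.norm_of_nonneg ht, normPrime_eq_norm]

theorem measurable_normPrime (n : ℕ) : Measurable (normPrime n) := by
  have : normPrime n = fun x => ‖projPrime n x‖ := funext normPrime_eq_norm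
  rw [this]
  exact (projPrime n).continuous_of_finiteDimensional.norm.measurable

theorem measurable_weight (n : ℕ) (a b : ℝ) : Measurable (weight n a b) :=
  ((measurable_normPrime n).pow_const a).mul (measurable_norm.pow_const b)

theorem weight_nonneg {n : ℕ} (a b : ℝ) (x : En n) : 0 ≤ weight n a b x :=
  mul_nonneg (Real.rpow_nonneg (normPrime_nonneg x) _) (Real.rpow_nonneg (norm_nonneg x) _)

theorem weight_smul {n : ℕ} (a b : ℝ) {t : ℝ} (ht : 0 < t) (x : En n) :
    weight n a b (t • x) = t ^ (a + b) * weight n a b x := by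
  rw [weight, weight, normPrime_smul ht.le, norm_smul, Real.norm_of_nonneg ht.le,
    Real.mul_rpow ht.le (normPrime_nonneg x), Real.mul_rpow ht.le (norm_nonneg x),
    Real.rpow_add ht]
  ring

theorem ae_forall_coord_ne_zero (n : ℕ) : ∀ᵐ x : En n, ∀ i, x i ≠ 0 := by
  refine ae_all_iff.2 fun i => ?_
  have h := Measure.addHaar_submodule (volume : Measure (En n))
    (LinearMap.ker (EuclideanSpace.proj (𝕜 := ℝ) i : En n →L[ℝ] ℝ).toLinearMap) ?_
  · rw [ae_iff]
    convert h using 2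
    ext x
    simp
  · intro htop
    have : EuclideanSpace.single i (1 : ℝ) ∈
      LinearMap.ker (EuclideanSpace.proj (𝕜 := ℝ) i : En n →L[ℝ] ℝ).toLinearMap := by
        rw [htop]; trivial
    simp at this

theorem normPrime_pos_of_coord_ne_zero {n : ℕ} (hn : 2 ≤ n) {x : En n} (hx : ∀ i, x i ≠ 0) :
    0 < normPrime n x :=
  (abs_pos.2 (hx ⟨0, by omega⟩)).trans_le (abs_coord_le_normPrime x (by simpa using by omega))

theorem integrableOn_abs_rpow {c : ℝ} (hc : -1 < c) :
    IntegrableOn (fun s : ℝ => |s| ^ c) (Ioc (-1) 1) := by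
  have h1 : IntegrableOn (fun s : ℝ => |s| ^ c) (Icc 0 1) := by
    have := (intervalIntegral.intervalIntegrable_rpow' hc (a := 0) (b := 1)).1
    rw [← integrableOn_Icc_iff_integrableOn_Ioc] at this
    refine this.congr_fun (fun s hs => ?_) measurableSet_Icc
    simp only [abs_of_nonneg hs.1]
  have h2 := h1.comp_neg
  simp only [abs_neg, neg_Icc, neg_zero] at h2
  refine (h2.union h1).mono_set fun s hs => ?_
  rcases le_total s 0 with h | h
  · exact Or.inl ⟨hs.1.le, h⟩
  · exact Or.inr ⟨h, hs.2⟩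

theorem exists_exponents {m : ℕ} (hm : 1 ≤ m) {a b : ℝ} (ha : -(m : ℝ) < a)
    (hab : -((m : ℝ) + 1) < a + b) :
    ∃ c e : ℝ, -1 < c ∧ c ≤ 0 ∧ -1 < e ∧ e ≤ 0 ∧ ∀ p r N : ℝ, 0 < p → 0 < r → p ≤ N → r ≤ N →
      N < 1 → p ^ a * N ^ b ≤ p ^ (c * m) * r ^ e := by
  have hm0 : (0 : ℝ) < m := by exact_mod_cast hm
  suffices h : ∃ α e : ℝ, -(m : ℝ) < α ∧ -1 < e ∧ e ≤ 0 ∧ ∀ p r N : ℝ, 0 < p → 0 < r →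
      p ≤ N → r ≤ N → N < 1 → p ^ a * N ^ b ≤ p ^ α * r ^ e by
    obtain ⟨α, e, hα, he1, he0, h⟩ := h
    refine ⟨min α 0 / m, e, ?_, ?_, he1, he0, fun p r N hp hr hpN hrN hN => ?_⟩
    · rw [lt_div_iff₀ hm0, lt_min_iff]
      constructor <;> linarith
    · exact div_nonpos_of_nonpos_of_nonneg (min_le_right _ _) hm0.le
    · rw [div_mul_cancel₀ _ hm0.ne']
      refine (h p r N hp hr hpN hrN hN).trans ?_
      gcongr ?_ * _
      exact Real.rpow_le_rpow_of_exponent_ge hp (hpN.trans hN.le) (min_le_left _ _)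
  rcases le_or_gt 0 b with hb | hb
  · refine ⟨a, 0, ha, by norm_num, le_rfl, fun p r N hp hr hpN hrN hN => ?_⟩
    rw [Real.rpow_zero]
    gcongr
    exact Real.rpow_le_one (hp.le.trans hpN) hN.le hb
  · obtain ⟨e, he1, he2⟩ : ∃ e, max (-1) b < e ∧ e < min 0 (a + b + m) :=
      exists_between (by
        rw [max_lt_iff, lt_min_iff, lt_min_iff]
        refine ⟨⟨by norm_num, by linarith⟩, hb, by linarith⟩)
    rw [max_lt_iff] at he1
    rw [lt_min_iff] at he2
    refine ⟨a + b - e, e, by linarith, he1.1, he2.1.le, fun p r N hp hr hpN hrN hN => ?_⟩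
    have hN0 : 0 < N := hp.trans_le hpN
    calc p ^ a * N ^ b = p ^ a * (N ^ (b - e) * N ^ e) := by
          rw [← Real.rpow_add hN0, sub_add_cancel]
      _ ≤ p ^ a * (p ^ (b - e) * r ^ e) := by
          gcongr ?_ * (?_ * ?_)
          · exact Real.rpow_le_rpow_of_nonpos hp hpN (by linarith)
          · exact Real.rpow_le_rpow_of_nonpos hr hrN he2.1.le
      _ = p ^ (a + b - e) * r ^ e := by
          rw [← mul_assoc, ← Real.rpow_add hp]
          ring_nf

theorem lintegral_weight_unit_ball_lt_top {n : ℕ} (hn : 2 ≤ n) {a b : ℝ}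
    (ha : -((n : ℝ) - 1) < a) (hab : -(n : ℝ) < a + b) :
    ∫⁻ x in ball (0 : En n) 1, ENNReal.ofReal (weight n a b x) < ⊤ := by
  obtain ⟨m, rfl⟩ : ∃ m, n = m + 1 := ⟨n - 1, by omega⟩
  push_cast at ha hab
  obtain ⟨c, e, hc1, hc0, he1, he0, hce⟩ :=
    exists_exponents (m := m) (by omega) (a := a) (b := b) (by linarith) (by linarith)
  set d : Fin (m + 1) → ℝ := fun i => if (i : ℕ) + 1 < m + 1 then c else e with hd
  set f : Fin (m + 1) → ℝ → ℝ := fun i => (Ioc (-1 : ℝ) 1).indicator fun s => |s| ^ d i with hf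
  have hfi : Integrable (fun x : En (m + 1) => ∏ i, f i (x i)) := by
    have h1 : Integrable (fun x : Fin (m + 1) → ℝ => ∏ i, f i (x i)) := by
      refine Integrable.fintype_prod fun i => ?_
      refine (integrable_indicator_iff measurableSet_Ioc).2 (integrableOn_abs_rpow ?_)
      simp only [hd]
      split_ifs <;> assumption
    exact ((PiLp.volume_preserving_ofLp (Fin (m + 1))).integrable_comp
      h1.aestronglyMeasurable).2 h1
  refine lt_of_le_of_lt ?_ hfi.lintegral_lt_top
  rw [← lintegral_indicator measurableSet_ball]
  refine lintegral_mono_ae ?_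
  filter_upwards [ae_forall_coord_ne_zero (m + 1)] with x hx
  by_cases hxB : x ∈ ball (0 : En (m + 1)) 1
  · rw [indicator_of_mem hxB]
    refine ENNReal.ofReal_le_ofReal ?_
    rw [mem_ball_zero_iff] at hxB
    have hcoord : ∀ i, |x i| ≤ ‖x‖ := fun i => PiLp.norm_apply_le x i
    have hp := normPrime_pos_of_coord_ne_zero hn hx
    have hfx : ∀ i, f i (x i) = |x i| ^ d i := by
      intro i
      have h := abs_lt.1 ((hcoord i).trans_lt hxB)
      have hmem : x i ∈ Ioc (-1 : ℝ) 1 := ⟨h.1, h.2.le⟩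
      simp only [hf, indicator_of_mem hmem]
    simp only [hfx]
    refine (hce _ |x (Fin.last m)| _ hp (abs_pos.2 (hx _)) (normPrime_le_norm x)
      (hcoord _) hxB).trans ?_
    rw [Fin.prod_univ_castSucc]
    have hlast : d (Fin.last m) = e := by simp [hd]
    rw [hlast]
    gcongr ?_ * _
    rw [Real.rpow_mul hp.le, Real.rpow_natCast]
    calc (normPrime (m + 1) x ^ c) ^ m = ∏ i : Fin m, normPrime (m + 1) x ^ c := by simp
      _ ≤ ∏ i : Fin m, |x i.castSucc| ^ d i.castSucc := by
        refine Finset.prod_le_prod (fun i _ => Real.rpow_nonneg hp.le _) fun i _ => ?_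
        have hdi : d i.castSucc = c := by simp [hd]
        rw [hdi]
        exact Real.rpow_le_rpow_of_nonpos (abs_pos.2 (hx _))
          (abs_coord_le_normPrime x (by simp)) hc0
  · rw [indicator_of_notMem hxB]; exact zero_le

theorem exists_lintegral_weight_ball_le {n : ℕ} (hn : 2 ≤ n) {a b : ℝ}
    (ha : -((n : ℝ) - 1) < a) (hab : -(n : ℝ) < a + b) :
    ∃ K : ℝ, 0 < K ∧ ∀ R : ℝ, 0 < R → ∫⁻ x in ball (0 : En n) R,
      ENNReal.ofReal (weight n a b x) ≤ ENNReal.ofReal (K * R ^ ((n : ℝ) + a + b)) := by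
  have hfin := lintegral_weight_unit_ball_lt_top hn ha hab
  set I := ∫⁻ x in ball (0 : En n) 1, ENNReal.ofReal (weight n a b x) with hI
  refine ⟨I.toReal + 1, by positivity, fun R hR => ?_⟩
  have hm : Measurable ((ball (0 : En n) R).indicator
      fun x => ENNReal.ofReal (weight n a b x)) :=
    (measurable_weight n a b).ennreal_ofReal.indicator measurableSet_ball
  have h := lintegral_comp_smul_add hm 0 hR
  have hl : ∫⁻ z, (ball (0 : En n) R).indicator (fun x => ENNReal.ofReal (weight n a b x))
      (0 + R • z) = ENNReal.ofReal (R ^ (a + b)) * I := by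
    rw [hI, ← lintegral_indicator measurableSet_ball,
      ← lintegral_const_mul' _ _ ENNReal.ofReal_ne_top]
    refine lintegral_congr fun z => ?_
    rw [zero_add]
    by_cases hz : z ∈ ball (0 : En n) 1
    · have hz' : R • z ∈ ball (0 : En n) R := by
        rw [mem_ball_zero_iff] at hz ⊢
        rw [norm_smul, Real.norm_of_nonneg hR.le]
        nlinarith
      rw [indicator_of_mem hz, indicator_of_mem hz', weight_smul a b hR,
        ENNReal.ofReal_mul (by positivity)]
    · have hz' : R • z ∉ ball (0 : En n) R := by
        rw [mem_ball_zero_iff] at hz ⊢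
        rw [norm_smul, Real.norm_of_nonneg hR.le]
        nlinarith
      rw [indicator_of_notMem hz, indicator_of_notMem hz', mul_zero]
  rw [hl, lintegral_indicator measurableSet_ball] at h
  have hRn : 0 < R ^ n := by positivity
  calc ∫⁻ x in ball (0 : En n) R, ENNReal.ofReal (weight n a b x)
      = ENNReal.ofReal (R ^ n) * (ENNReal.ofReal (R ^ n)⁻¹ *
          ∫⁻ x in ball (0 : En n) R, ENNReal.ofReal (weight n a b x)) := by
        rw [← mul_assoc, ← ENNReal.ofReal_mul hRn.le, mul_inv_cancel₀ hRn.ne',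
          ENNReal.ofReal_one, one_mul]
    _ = ENNReal.ofReal (R ^ n) * (ENNReal.ofReal (R ^ (a + b)) * ENNReal.ofReal I.toReal) := by
        rw [← h, ENNReal.ofReal_toReal hfin.ne]
    _ = ENNReal.ofReal (I.toReal * R ^ ((n : ℝ) + a + b)) := by
        rw [← ENNReal.ofReal_mul (by positivity), ← ENNReal.ofReal_mul (by positivity),
          add_assoc, Real.rpow_add hR (n : ℝ), Real.rpow_natCast]
        congr 1
        ring
    _ ≤ _ := by
        gcongr
        linarith

/-- The weight `|x'|^a |x|^b`, with the value `⊤` on the axis `x' = 0`. -/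
def axisWeight (n : ℕ) (a b : ℝ) (x : En n) : ℝ≥0∞ :=
  open Classical in if normPrime n x = 0 then ⊤ else ENNReal.ofReal (weight n a b x)

theorem measurable_axisWeight (n : ℕ) (a b : ℝ) : Measurable (axisWeight n a b) := by
  classical
  unfold axisWeight
  exact Measurable.ite (measurable_normPrime n (measurableSet_singleton 0)) measurable_const
    (measurable_weight n a b).ennreal_ofReal

theorem axisWeight_of_pos {n : ℕ} {a b : ℝ} {x : En n} (hx : 0 < normPrime n x) :
    axisWeight n a b x = ENNReal.ofReal (weight n a b x) := by
  rw [axisWeight, if_neg hx.ne']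

theorem weight_pos {n : ℕ} {a b : ℝ} {x : En n} (hx : 0 < normPrime n x) :
    0 < weight n a b x :=
  mul_pos (Real.rpow_pos_of_pos hx _)
    (Real.rpow_pos_of_pos (hx.trans_le (normPrime_le_norm x)) _)

theorem axisWeight_ne_zero {n : ℕ} (a b : ℝ) (x : En n) : axisWeight n a b x ≠ 0 := by
  rcases (normPrime_nonneg x).eq_or_lt with h | h
  · rw [axisWeight, if_pos h.symm]; exact ENNReal.top_ne_zero
  · rw [axisWeight_of_pos h]; simpa using weight_pos h

theorem ae_normPrime_pos {n : ℕ} (hn : 2 ≤ n) : ∀ᵐ x : En n, 0 < normPrime n x := by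
  filter_upwards [ae_forall_coord_ne_zero n] with x hx
  exact normPrime_pos_of_coord_ne_zero hn hx

theorem setLIntegral_axisWeight {n : ℕ} (hn : 2 ≤ n) (a b : ℝ) (s : Set (En n)) :
    ∫⁻ x in s, axisWeight n a b x = ∫⁻ x in s, ENNReal.ofReal (weight n a b x) := by
  refine lintegral_congr_ae (ae_restrict_of_ae ?_)
  filter_upwards [ae_normPrime_pos hn] with x hx
  exact axisWeight_of_pos hx

theorem exists_volume_ball_eq (n : ℕ) : ∃ V : ℝ, 0 < V ∧ ∀ (x : En n) (r : ℝ), 0 < r →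
    volume (ball x r) = ENNReal.ofReal (V * r ^ n) := by
  have hfin : volume (ball (0 : En n) 1) ≠ ⊤ := measure_ball_lt_top.ne
  have hpos : volume (ball (0 : En n) 1) ≠ 0 := (measure_ball_pos _ _ one_pos).ne'
  refine ⟨(volume (ball (0 : En n) 1)).toReal, ENNReal.toReal_pos hpos hfin, fun x r hr => ?_⟩
  rw [Measure.addHaar_ball_of_pos _ x hr, finrank_euclideanSpace_fin, mul_comm,
    ENNReal.ofReal_mul ENNReal.toReal_nonneg, ENNReal.ofReal_toReal hfin]

theorem mul_three_mul_rpow_le {K r N : ℝ} {n : ℕ} {s : ℝ} (hK : 0 < K) (hr : 0 < r) (hN : 0 < N)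
    (hNr : N ≤ 2 * r) (hs : s ≤ 0) :
    K * (3 * r) ^ ((n : ℝ) + s) ≤ K * 3 ^ ((n : ℝ) + s) * 2 ^ (-s) * r ^ n * N ^ s := by
  have h1 : (2 * r) ^ s ≤ N ^ s := Real.rpow_le_rpow_of_nonpos hN hNr hs
  have h2 : r ^ s = 2 ^ (-s) * (2 * r) ^ s := by
    rw [Real.mul_rpow zero_le_two hr.le, ← mul_assoc, ← Real.rpow_add zero_lt_two,
      neg_add_cancel, Real.rpow_zero, one_mul]
  rw [Real.mul_rpow zero_le_three hr.le, Real.rpow_add hr, h2, Real.rpow_natCast]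
  calc K * (3 ^ ((n : ℝ) + s) * (r ^ n * (2 ^ (-s) * (2 * r) ^ s)))
      = K * 3 ^ ((n : ℝ) + s) * 2 ^ (-s) * r ^ n * (2 * r) ^ s := by ring
    _ ≤ _ := by gcongr

theorem exists_lintegral_normPrime_rpow_le {n : ℕ} (hn : 2 ≤ n) {a : ℝ}
    (ha : -((n : ℝ) - 1) < a) (ha0 : a ≤ 0) :
    ∃ K : ℝ, 0 < K ∧ ∀ (x : En n) (r : ℝ), 0 < r → 0 < normPrime n x →
      ∫⁻ y in ball x r, ENNReal.ofReal (normPrime n y ^ a) ≤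
        ENNReal.ofReal (K * r ^ n * normPrime n x ^ a) := by
  obtain ⟨K, hK, hKb⟩ := exists_lintegral_weight_ball_le hn (a := a) (b := 0) ha (by linarith)
  obtain ⟨V, hV, hVb⟩ := exists_volume_ball_eq n
  refine ⟨K * 3 ^ ((n : ℝ) + a) * 2 ^ (-a) + 2 ^ (-a) * V, by positivity, fun x r hr hx => ?_⟩
  rcases le_or_gt (normPrime n x) (2 * r) with h | h
  · have hker : projPrime n (x - projPrime n x) = 0 := by
      ext i
      rw [map_sub, PiLp.sub_apply, projPrime_apply, projPrime_apply, projPrime_apply]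
      split_ifs <;> simp
    set d := x - projPrime n x with hd
    have hshift : ∀ y, normPrime n (d + y) = normPrime n y := by
      intro y
      rw [normPrime_eq_norm, normPrime_eq_norm, map_add, hker, zero_add]
    have hsub : ball x r ⊆ ball d (3 * r) := by
      refine ball_subset_ball' ?_
      rw [dist_eq_norm, hd, sub_sub_cancel, ← normPrime_eq_norm]
      linarith
    calc ∫⁻ y in ball x r, ENNReal.ofReal (normPrime n y ^ a)
        ≤ ∫⁻ y in ball d (3 * r), ENNReal.ofReal (normPrime n y ^ a) :=
          lintegral_mono_set hsub
      _ = ∫⁻ y, (ball d (3 * r)).indicator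
            (fun y => ENNReal.ofReal (normPrime n y ^ a)) (d + y) := by
          rw [lintegral_add_left_eq_self, lintegral_indicator measurableSet_ball]
      _ = ∫⁻ y in ball 0 (3 * r), ENNReal.ofReal (weight n a 0 y) := by
          rw [← lintegral_indicator measurableSet_ball]
          refine lintegral_congr fun y => ?_
          simp only [indicator, mem_ball, dist_self_add_left, dist_zero_right, hshift, weight,
            Real.rpow_zero, mul_one]
      _ ≤ ENNReal.ofReal (K * (3 * r) ^ ((n : ℝ) + a)) := by
          simpa using hKb (3 * r) (by positivity)
      _ ≤ _ := by
          refine ENNReal.ofReal_le_ofReal ((mul_three_mul_rpow_le hK hr hx h ha0).trans ?_)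
          have : 0 ≤ 2 ^ (-a) * V := by positivity
          gcongr
          linarith
  · calc ∫⁻ y in ball x r, ENNReal.ofReal (normPrime n y ^ a)
        ≤ ∫⁻ y in ball x r, ENNReal.ofReal (2 ^ (-a) * normPrime n x ^ a) := by
          refine setLIntegral_mono' measurableSet_ball fun y hy => ?_
          refine ENNReal.ofReal_le_ofReal ?_
          have h1 : normPrime n x / 2 ≤ normPrime n y := by
            have := normPrime_le_add x y
            rw [mem_ball] at hy
            linarith
          refine (Real.rpow_le_rpow_of_nonpos (by positivity) h1 ha0).trans_eq ?_
          rw [Real.div_rpow hx.le zero_le_two, Real.rpow_neg zero_le_two]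
          ring
      _ = ENNReal.ofReal (2 ^ (-a) * V * r ^ n * normPrime n x ^ a) := by
          rw [setLIntegral_const, hVb x r hr, ← ENNReal.ofReal_mul (by positivity)]
          congr 1
          ring
      _ ≤ _ := by
          refine ENNReal.ofReal_le_ofReal ?_
          have : 0 ≤ K * 3 ^ ((n : ℝ) + a) * 2 ^ (-a) := by positivity
          gcongr
          linarith

theorem rpow_le_two_rpow_abs_mul {N y b : ℝ} (hN : 0 < N) (h1 : N / 2 ≤ y) (h2 : y ≤ 2 * N) :
    y ^ b ≤ 2 ^ |b| * N ^ b := by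
  have hy : 0 < y := by linarith
  rcases le_total 0 b with hb | hb
  · rw [abs_of_nonneg hb, ← Real.mul_rpow zero_le_two hN.le]
    exact Real.rpow_le_rpow hy.le h2 hb
  · rw [abs_of_nonpos hb]
    refine (Real.rpow_le_rpow_of_nonpos (by positivity) h1 hb).trans_eq ?_
    rw [Real.div_rpow hN.le zero_le_two, Real.rpow_neg zero_le_two]
    ring

/-- The Muckenhoupt `A₁` property of `axisWeight`. -/
theorem exists_lintegral_axisWeight_ball_le {n : ℕ} (hn : 2 ≤ n) {a b : ℝ}
    (ha : -((n : ℝ) - 1) < a) (ha0 : a ≤ 0) (hab : -(n : ℝ) < a + b) (hab0 : a + b ≤ 0) :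
    ∃ K : ℝ, 0 < K ∧ ∀ (x : En n) (r : ℝ), 0 < r →
      ∫⁻ y in ball x r, axisWeight n a b y ≤ ENNReal.ofReal (K * r ^ n) * axisWeight n a b x := by
  obtain ⟨K, hK, hKb⟩ := exists_lintegral_weight_ball_le hn ha hab
  obtain ⟨K', hK', hKb'⟩ := exists_lintegral_normPrime_rpow_le hn ha ha0
  refine ⟨K * 3 ^ ((n : ℝ) + (a + b)) * 2 ^ (-(a + b)) + 2 ^ |b| * K', by positivity,
    fun x r hr => ?_⟩
  rcases (normPrime_nonneg x).eq_or_lt with hx | hx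
  · rw [show axisWeight n a b x = ⊤ by rw [axisWeight, if_pos hx.symm], ENNReal.mul_top]
    · exact le_top
    · rw [Ne, ENNReal.ofReal_eq_zero, not_le]
      positivity
  have hN : 0 < ‖x‖ := hx.trans_le (normPrime_le_norm x)
  rw [setLIntegral_axisWeight hn, axisWeight_of_pos hx, ← ENNReal.ofReal_mul (by positivity)]
  rcases le_or_gt ‖x‖ (2 * r) with h | h
  · have hsub : ball x r ⊆ ball 0 (3 * r) := by
      refine ball_subset_ball' ?_
      rw [dist_zero_right]
      linarith
    calc ∫⁻ y in ball x r, ENNReal.ofReal (weight n a b y)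
        ≤ ∫⁻ y in ball 0 (3 * r), ENNReal.ofReal (weight n a b y) := lintegral_mono_set hsub
      _ ≤ ENNReal.ofReal (K * (3 * r) ^ ((n : ℝ) + (a + b))) := by
          simpa [add_assoc] using hKb (3 * r) (by positivity)
      _ ≤ _ := by
          refine ENNReal.ofReal_le_ofReal ((mul_three_mul_rpow_le hK hr hN h hab0).trans ?_)
          have h0 : 0 ≤ 2 ^ |b| * K' := by positivity
          have h1 : ‖x‖ ^ (a + b) ≤ weight n a b x := by
            rw [Real.rpow_add hN, weight]
            gcongr ?_ * _
            exact Real.rpow_le_rpow_of_nonpos hx (normPrime_le_norm x) ha0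
          gcongr
          linarith
  · calc ∫⁻ y in ball x r, ENNReal.ofReal (weight n a b y)
        ≤ ∫⁻ y in ball x r, ENNReal.ofReal (2 ^ |b| * ‖x‖ ^ b) *
            ENNReal.ofReal (normPrime n y ^ a) := by
          refine setLIntegral_mono' measurableSet_ball fun y hy => ?_
          rw [← ENNReal.ofReal_mul (by positivity), mul_comm, weight]
          refine ENNReal.ofReal_le_ofReal ?_
          have := normPrime_nonneg y
          gcongr
          rw [mem_ball, dist_eq_norm] at hy
          have h1 := norm_sub_norm_le y x
          have h2 := norm_sub_norm_le x y
          rw [norm_sub_rev] at h2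
          exact rpow_le_two_rpow_abs_mul hN (by linarith) (by linarith)
      _ = ENNReal.ofReal (2 ^ |b| * ‖x‖ ^ b) *
            ∫⁻ y in ball x r, ENNReal.ofReal (normPrime n y ^ a) :=
          lintegral_const_mul' _ _ ENNReal.ofReal_ne_top
      _ ≤ ENNReal.ofReal (2 ^ |b| * ‖x‖ ^ b) *
            ENNReal.ofReal (K' * r ^ n * normPrime n x ^ a) := by
          gcongr
          exact hKb' x r hr hx
      _ = ENNReal.ofReal (2 ^ |b| * K' * r ^ n * weight n a b x) := by
          rw [← ENNReal.ofReal_mul (by positivity), weight]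
          congr 1
          ring
      _ ≤ _ := by
          refine ENNReal.ofReal_le_ofReal ?_
          have : 0 ≤ K * 3 ^ ((n : ℝ) + (a + b)) * 2 ^ (-(a + b)) := by positivity
          have := weight_nonneg a b x
          gcongr
          linarith

theorem setLIntegral_segInt_eq {n : ℕ} {f : En n → ℝ≥0∞} (hf : Measurable f) (x : En n)
    (S : Set (En n)) :
    ∫⁻ z in S, segInt f x z = ∫⁻ t in Ioo (0 : ℝ) 1, ∫⁻ z in S, f (x + t • (z - x)) := by
  unfold segInt
  refine lintegral_lintegral_swap (Measurable.aemeasurable ?_)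
  exact hf.comp (f := fun p : En n × ℝ => x + p.2 • (p.1 - x)) (by fun_prop)

theorem setLIntegral_mul_segInt_eq {n : ℕ} {f ψ : En n → ℝ≥0∞} (hf : Measurable f)
    (hψ : Measurable ψ) (S : Set (En n)) :
    ∫⁻ x in S, ψ x * ∫⁻ z in S, segInt f x z =
      ∫⁻ t in Ioo (0 : ℝ) 1, ∫⁻ x in S, ψ x * ∫⁻ z in S, f (x + t • (z - x)) := by
  have hm : Measurable fun p : En n × ℝ => ∫⁻ z in S, f (p.1 + p.2 • (z - p.1)) :=
    Measurable.lintegral_prod_right' (f := fun p : (En n × ℝ) × En n =>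
      f (p.1.1 + p.1.2 • (p.2 - p.1.1))) (hf.comp (by fun_prop))
  have h1 : ∀ x, ψ x * ∫⁻ z in S, segInt f x z =
      ∫⁻ t in Ioo (0 : ℝ) 1, ψ x * ∫⁻ z in S, f (x + t • (z - x)) := by
    intro x
    have hmx : Measurable fun t : ℝ => ∫⁻ z in S, f (x + t • (z - x)) :=
      hm.comp measurable_prodMk_left
    rw [setLIntegral_segInt_eq hf, lintegral_const_mul _ hmx]
  simp only [h1]
  exact lintegral_lintegral_swap ((hψ.comp measurable_fst).mul hm).aemeasurable

theorem setLIntegral_Ioo_le {F : ℝ → ℝ≥0∞} {c : ℝ≥0∞} (h : ∀ t, 0 < t → t < 1 → F t ≤ c) :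
    ∫⁻ t in Ioo (0 : ℝ) 1, F t ≤ c := by
  calc ∫⁻ t in Ioo (0 : ℝ) 1, F t ≤ ∫⁻ t in Ioo (0 : ℝ) 1, c :=
        setLIntegral_mono' measurableSet_Ioo fun t ht => h t ht.1 ht.2
    _ = c := by simp

theorem ofReal_inv_pow_mul {n : ℕ} {K R t : ℝ} (ht : 0 < t) :
    ENNReal.ofReal (t ^ n)⁻¹ * ENNReal.ofReal (K * (2 * R * t) ^ n) =
      ENNReal.ofReal (K * 2 ^ n * R ^ n) := by
  rw [← ENNReal.ofReal_mul (by positivity), mul_pow, mul_pow]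
  congr 1
  field_simp

theorem lintegral_segInt_ball_le {n : ℕ} {φ : En n → ℝ≥0∞} (hφ : Measurable φ) {K R : ℝ}
    (hR : 0 < R) (hK : ∀ (x : En n) (r : ℝ), 0 < r →
      ∫⁻ y in ball x r, φ y ≤ ENNReal.ofReal (K * r ^ n) * φ x)
    {x : En n} (hx : x ∈ ball (0 : En n) R) :
    ∫⁻ z in ball (0 : En n) R, segInt φ x z ≤ ENNReal.ofReal (K * 2 ^ n * R ^ n) * φ x := by
  rw [setLIntegral_segInt_eq hφ]
  refine setLIntegral_Ioo_le fun t ht0 ht1 => ?_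
  calc ∫⁻ z in ball (0 : En n) R, φ (x + t • (z - x))
      ≤ ENNReal.ofReal (t ^ n)⁻¹ * ∫⁻ y in ball (0 : En n) R ∩ ball x (2 * R * t), φ y :=
        setLIntegral_segment_le hφ ht0 ht1 hx
    _ ≤ ENNReal.ofReal (t ^ n)⁻¹ * (ENNReal.ofReal (K * (2 * R * t) ^ n) * φ x) := by
        gcongr
        exact (lintegral_mono_set inter_subset_right).trans (hK x _ (by positivity))
    _ = _ := by rw [← mul_assoc, ofReal_inv_pow_mul ht0]

theorem lintegral_mul_segInt_ball_le {n : ℕ} {ψ : En n → ℝ≥0∞} (hψ : Measurable ψ) {K R : ℝ}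
    (hR : 0 < R) (hK : ∀ (x : En n) (r : ℝ), 0 < r →
      ∫⁻ y in ball x r, ψ y ≤ ENNReal.ofReal (K * r ^ n) * ψ x)
    {f : En n → ℝ≥0∞} (hf : Measurable f) :
    ∫⁻ x in ball (0 : En n) R, ψ x * ∫⁻ z in ball (0 : En n) R, segInt f x z ≤
      ENNReal.ofReal (K * 2 ^ n * R ^ n) * ∫⁻ x in ball (0 : En n) R, ψ x * f x := by
  rw [setLIntegral_mul_segInt_eq hf hψ]
  refine setLIntegral_Ioo_le fun t ht0 ht1 => ?_
  set E : Set (En n × En n) := {p | dist p.2 p.1 < 2 * R * t} with hE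
  have hEm : MeasurableSet E := (isOpen_lt (by fun_prop) continuous_const).measurableSet
  have hEi : Measurable (E.indicator fun _ => (1 : ℝ≥0∞)) := measurable_const.indicator hEm
  have hin : ∀ x y : En n, ∀ h : En n → ℝ≥0∞,
      E.indicator (fun _ => (1 : ℝ≥0∞)) (x, y) * h y = (ball x (2 * R * t)).indicator h y := by
    intro x y h
    by_cases hxy : dist y x < 2 * R * t
    · rw [indicator_of_mem (show (x, y) ∈ E from hxy),
        indicator_of_mem (show y ∈ ball x (2 * R * t) from hxy), one_mul]
    · rw [indicator_of_notMem (show (x, y) ∉ E from hxy),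
        indicator_of_notMem (show y ∉ ball x (2 * R * t) from hxy), zero_mul]
  have hsymm : ∀ x y : En n, E.indicator (fun _ => (1 : ℝ≥0∞)) (x, y) =
      E.indicator (fun _ => (1 : ℝ≥0∞)) (y, x) := by
    intro x y
    simp only [indicator, hE, mem_ofPred_eq, dist_comm]
  calc ∫⁻ x in ball (0 : En n) R, ψ x * ∫⁻ z in ball (0 : En n) R, f (x + t • (z - x))
      ≤ ∫⁻ x in ball (0 : En n) R, ENNReal.ofReal (t ^ n)⁻¹ * ∫⁻ y in ball (0 : En n) R,
          ψ x * (E.indicator (fun _ => (1 : ℝ≥0∞)) (x, y) * f y) := by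
        refine setLIntegral_mono' measurableSet_ball fun x hx => ?_
        have h1 : Measurable fun y => E.indicator (fun _ => (1 : ℝ≥0∞)) (x, y) * f y :=
          (hEi.comp measurable_prodMk_left).mul hf
        rw [lintegral_const_mul _ h1, mul_left_comm]
        refine mul_le_mul_right ((setLIntegral_segment_le hf ht0 ht1 hx).trans_eq ?_) _
        simp only [hin]
        rw [lintegral_indicator measurableSet_ball, Measure.restrict_restrict measurableSet_ball,
          inter_comm]
    _ = ENNReal.ofReal (t ^ n)⁻¹ * ∫⁻ y in ball (0 : En n) R, ∫⁻ x in ball (0 : En n) R,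
          ψ x * (E.indicator (fun _ => (1 : ℝ≥0∞)) (x, y) * f y) := by
        rw [lintegral_const_mul' _ _ ENNReal.ofReal_ne_top, lintegral_lintegral_swap]
        exact ((hψ.comp measurable_fst).mul
          (hEi.mul (hf.comp measurable_snd))).aemeasurable
    _ ≤ ENNReal.ofReal (t ^ n)⁻¹ * ∫⁻ y in ball (0 : En n) R,
          ENNReal.ofReal (K * (2 * R * t) ^ n) * (ψ y * f y) := by
        gcongr with y
        have h1 : Measurable fun x => E.indicator (fun _ => (1 : ℝ≥0∞)) (y, x) * ψ x :=
          (hEi.comp measurable_prodMk_left).mul hψ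
        calc ∫⁻ x in ball (0 : En n) R, ψ x * (E.indicator (fun _ => (1 : ℝ≥0∞)) (x, y) * f y)
            = ∫⁻ x in ball (0 : En n) R,
                (E.indicator (fun _ => (1 : ℝ≥0∞)) (y, x) * ψ x) * f y := by
              refine lintegral_congr fun x => ?_
              rw [hsymm x y]
              ring
          _ = (∫⁻ x in ball (0 : En n) R, (ball y (2 * R * t)).indicator ψ x) * f y := by
              rw [lintegral_mul_const _ h1]
              simp only [hin]
          _ ≤ (ENNReal.ofReal (K * (2 * R * t) ^ n) * ψ y) * f y := by
              gcongr
              refine (setLIntegral_le_lintegral _ _).trans ?_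
              rw [lintegral_indicator measurableSet_ball]
              exact hK y _ (by positivity)
          _ = _ := by ring
    _ = _ := by
        rw [lintegral_const_mul' _ _ ENNReal.ofReal_ne_top, ← mul_assoc, ofReal_inv_pow_mul ht0]

theorem lintegral_lintegral_segment_le {n : ℕ} {R V : ℝ} (hV : 0 ≤ V)
    (hvol : volume (ball (0 : En n) R) = ENNReal.ofReal V) {f : En n → ℝ≥0∞}
    (hf : Measurable f) {t : ℝ} (ht0 : 0 < t) (ht1 : t < 1) :
    ∫⁻ x in ball (0 : En n) R, ∫⁻ z in ball (0 : En n) R, f (x + t • (z - x)) ≤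
      ENNReal.ofReal (V * 2 ^ n) * ∫⁻ x in ball (0 : En n) R, f x := by
  have haux : ∀ t : ℝ, 1 / 2 ≤ t → t < 1 →
      ∫⁻ x in ball (0 : En n) R, ∫⁻ z in ball (0 : En n) R, f (x + t • (z - x)) ≤
      ENNReal.ofReal (V * 2 ^ n) * ∫⁻ x in ball (0 : En n) R, f x := by
    intro t ht ht1
    have ht0 : 0 < t := by linarith
    calc ∫⁻ x in ball (0 : En n) R, ∫⁻ z in ball (0 : En n) R, f (x + t • (z - x))
        ≤ ∫⁻ x in ball (0 : En n) R,
            ENNReal.ofReal (2 ^ n) * ∫⁻ y in ball (0 : En n) R, f y := by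
          refine setLIntegral_mono' measurableSet_ball fun x hx => ?_
          refine (setLIntegral_segment_le hf ht0 ht1 hx).trans ?_
          gcongr
          · rw [← inv_pow]
            gcongr
            rw [inv_le_comm₀ ht0 zero_lt_two]
            linarith
          · exact inter_subset_left
      _ = _ := by
          rw [setLIntegral_const, hvol, ENNReal.ofReal_mul hV]
          ring
  rcases le_or_gt (1 / 2) t with h | h
  · exact haux t h ht1
  · refine le_of_eq_of_le ?_ (haux (1 - t) (by linarith) (by linarith))
    rw [lintegral_lintegral_swap]
    · refine lintegral_congr fun z => lintegral_congr fun x => ?_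
      congr 1
      module
    · exact (hf.comp (f := fun p : En n × En n => p.1 + t • (p.2 - p.1))
        (by fun_prop)).aemeasurable

/-- Points of `B_R` near its boundary that are visible from `x` along segments staying at
distance at least `‖x‖ / 4` from the origin. -/
def outwardSet (n : ℕ) (R : ℝ) (x : En n) : Set (En n) :=
  {z ∈ ball (0 : En n) R | 5 * R / 8 ≤ ‖z‖ ∧ -(R * ‖x‖ / 8) ≤ inner ℝ x z}

theorem measurableSet_outwardSet {n : ℕ} (R : ℝ) (x : En n) :
    MeasurableSet (outwardSet n R x) := by
  have h : Continuous fun z : En n => inner ℝ x z := continuous_const.inner continuous_id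
  exact measurableSet_ball.inter (((isClosed_le continuous_const continuous_norm).inter
    (isClosed_le (f := fun _ => -(R * ‖x‖ / 8)) continuous_const h)).measurableSet)

theorem norm_le_four_mul_norm_segment {n : ℕ} {R : ℝ} {x z : En n}
    (hx : x ∈ ball (0 : En n) R) (hz : z ∈ outwardSet n R x) (t : ℝ) (ht0 : 0 < t)
    (ht1 : t < 1) : ‖x‖ ≤ 4 * ‖x + t • (z - x)‖ := by
  obtain ⟨-, hz1, hz2⟩ := hz
  rw [mem_ball_zero_iff] at hx
  have hsq : ‖x + t • (z - x)‖ ^ 2 =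
      (1 - t) ^ 2 * ‖x‖ ^ 2 + 2 * (t * (1 - t)) * inner ℝ x z + t ^ 2 * ‖z‖ ^ 2 := by
    rw [show x + t • (z - x) = (1 - t) • x + t • z by module, norm_add_sq_real, norm_smul,
      norm_smul, inner_smul_left, inner_smul_right, Real.norm_eq_abs, Real.norm_eq_abs, mul_pow,
      mul_pow, sq_abs, sq_abs, starRingEnd_apply, star_trivial]
    ring
  have hx0 := norm_nonneg x
  have hz0 := norm_nonneg z
  have hin : -(‖x‖ * ‖z‖ / 5) ≤ inner ℝ x z := by nlinarith
  have hts : 0 ≤ t * (1 - t) := mul_nonneg ht0.le (by linarith)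
  have hxz : ‖x‖ * (5 / 8) ≤ ‖z‖ := by linarith
  refine abs_le_of_sq_le_sq' ?_ (by positivity) |>.2
  have h1 : 4 / 5 * ((1 - t) ^ 2 * ‖x‖ ^ 2 + t ^ 2 * ‖z‖ ^ 2) ≤ ‖x + t • (z - x)‖ ^ 2 := by
    rw [hsq]
    nlinarith [mul_le_mul_of_nonneg_left hin hts, sq_nonneg ((1 - t) * ‖x‖ - t * ‖z‖)]
  have h2 : 25 / 64 * ‖x‖ ^ 2 ≤ ‖z‖ ^ 2 := by nlinarith
  have h3 : t ^ 2 * (25 / 64 * ‖x‖ ^ 2) ≤ t ^ 2 * ‖z‖ ^ 2 := by gcongr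
  have h4 : 5 / 64 * ‖x‖ ^ 2 ≤ ((1 - t) ^ 2 + 25 / 64 * t ^ 2) * ‖x‖ ^ 2 := by
    gcongr
    nlinarith [sq_nonneg (89 * t - 64)]
  nlinarith

theorem exists_norm_eq_one_inner_nonneg {n : ℕ} (hn : 2 ≤ n) (x y : En n) :
    ∃ e : En n, ‖e‖ = 1 ∧ 0 ≤ inner ℝ x e ∧ 0 ≤ inner ℝ y e := by
  obtain ⟨e, he, hxe⟩ : ∃ e : En n, ‖e‖ = 1 ∧ inner ℝ x e = 0 := by
    have hlt : Module.finrank ℝ (Submodule.span ℝ {x}) < Module.finrank ℝ (En n) := by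
      rw [finrank_euclideanSpace_fin]
      exact (finrank_span_le_card (R := ℝ) ({x} : Set (En n))).trans_lt (by simpa using by omega)
    have hne : (Submodule.span ℝ {x})ᗮ ≠ ⊥ := by
      intro h
      rw [Submodule.orthogonal_eq_bot_iff] at h
      rw [h, finrank_top] at hlt
      exact lt_irrefl _ hlt
    obtain ⟨v, hv, hv0⟩ := Submodule.exists_mem_ne_zero_of_ne_bot hne
    refine ⟨‖v‖⁻¹ • v, norm_smul_inv_norm hv0, ?_⟩
    rw [inner_smul_right, Submodule.mem_orthogonal_singleton_iff_inner_right.1 hv, mul_zero]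
  rcases le_total 0 (inner ℝ y e) with h | h
  · exact ⟨e, he, hxe.ge, h⟩
  · refine ⟨-e, by rw [norm_neg, he], ?_, ?_⟩
    · rw [inner_neg_right, hxe, neg_zero]
    · rw [inner_neg_right]; linarith

theorem ball_subset_outwardSet {n : ℕ} {R : ℝ} (hR : 0 < R) {x e : En n} (he : ‖e‖ = 1)
    (hxe : 0 ≤ inner ℝ x e) :
    ball ((3 / 4 * R) • e) (R / 8) ⊆ outwardSet n R x := by
  intro z hz
  have hc : ‖(3 / 4 * R) • e‖ = 3 / 4 * R := by
    rw [norm_smul, he, mul_one, Real.norm_of_nonneg (by positivity)]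
  rw [mem_ball, dist_eq_norm] at hz
  have h1 := norm_sub_norm_le z ((3 / 4 * R) • e)
  have h2 := norm_sub_norm_le ((3 / 4 * R) • e) z
  rw [norm_sub_rev] at h2
  refine ⟨?_, ?_, ?_⟩
  · rw [mem_ball_zero_iff]; linarith
  · linarith
  · have h3 : inner ℝ x z = 3 / 4 * R * inner ℝ x e + inner ℝ x (z - (3 / 4 * R) • e) := by
      rw [inner_sub_right, inner_smul_right]; ring
    have h4 := neg_le_of_abs_le (abs_real_inner_le_norm x (z - (3 / 4 * R) • e))
    have h5 : ‖x‖ * ‖z - (3 / 4 * R) • e‖ ≤ ‖x‖ * (R / 8) := by gcongr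
    have h6 : 0 ≤ 3 / 4 * R * inner ℝ x e := by positivity
    linarith

theorem lintegral_norm_rpow_mul_segInt_outward_le {n : ℕ} {R V β : ℝ} (hβ : 0 ≤ β) (hV : 0 ≤ V)
    (hvol : volume (ball (0 : En n) R) = ENNReal.ofReal V) {f : En n → ℝ≥0∞}
    (hf : Measurable f) :
    ∫⁻ x in ball (0 : En n) R, ENNReal.ofReal (‖x‖ ^ β) *
        ∫⁻ z in outwardSet n R x, segInt f x z ≤
      ENNReal.ofReal (4 ^ β * (V * 2 ^ n)) *
        ∫⁻ x in ball (0 : En n) R, ENNReal.ofReal (‖x‖ ^ β) * f x := by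
  set h : En n → ℝ≥0∞ := fun x => ENNReal.ofReal (‖x‖ ^ β) * f x with hh
  have hhm : Measurable h := (measurable_norm.pow_const β).ennreal_ofReal.mul hf
  calc ∫⁻ x in ball (0 : En n) R, ENNReal.ofReal (‖x‖ ^ β) *
        ∫⁻ z in outwardSet n R x, segInt f x z
      ≤ ∫⁻ x in ball (0 : En n) R, ENNReal.ofReal (4 ^ β) *
          (1 * ∫⁻ z in ball (0 : En n) R, segInt h x z) := by
        refine setLIntegral_mono' measurableSet_ball fun x hx => ?_
        rw [one_mul, ← lintegral_const_mul' _ _ ENNReal.ofReal_ne_top,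
          ← lintegral_const_mul' _ _ ENNReal.ofReal_ne_top]
        refine le_trans ?_ (lintegral_mono_set (s := outwardSet n R x) fun z hz => hz.1)
        refine setLIntegral_mono' (measurableSet_outwardSet R x) fun z hz => ?_
        rw [segInt, segInt, ← lintegral_const_mul' _ _ ENNReal.ofReal_ne_top,
          ← lintegral_const_mul' _ _ ENNReal.ofReal_ne_top]
        refine setLIntegral_mono' measurableSet_Ioo fun t ht => ?_
        rw [hh, ← mul_assoc, ← ENNReal.ofReal_mul (by positivity),
          ← Real.mul_rpow zero_le_four (norm_nonneg _)]
        gcongr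
        exact norm_le_four_mul_norm_segment hx hz t ht.1 ht.2
    _ = ENNReal.ofReal (4 ^ β) * ∫⁻ t in Ioo (0 : ℝ) 1, ∫⁻ x in ball (0 : En n) R,
          ∫⁻ z in ball (0 : En n) R, h (x + t • (z - x)) := by
        rw [lintegral_const_mul' _ _ ENNReal.ofReal_ne_top,
          setLIntegral_mul_segInt_eq hhm (ψ := fun _ => 1) measurable_const]
        simp only [one_mul]
    _ ≤ ENNReal.ofReal (4 ^ β) * (ENNReal.ofReal (V * 2 ^ n) *
          ∫⁻ x in ball (0 : En n) R, h x) := by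
        gcongr
        exact setLIntegral_Ioo_le fun t ht0 ht1 =>
          lintegral_lintegral_segment_le hV hvol hhm ht0 ht1
    _ = _ := by rw [← mul_assoc, ← ENNReal.ofReal_mul (by positivity)]

theorem isoperimetric_constant_eq {n : ℕ} {q s R K₀ k₁ k₂ k₃ : ℝ} (hR : 0 < R) (hK₀ : 0 < K₀)
    (hk₁ : 0 < k₁) (hk₃ : 0 < k₃) :
    (K₀ * R ^ s) ^ q * (8 * R / (k₃ * R ^ n)) ^ q * (k₁ * R ^ n) ^ (q - 1) * (k₂ * R ^ n) =
      K₀ ^ q * (8 / k₃) ^ q * k₁ ^ (q - 1) * k₂ * R ^ (q * (s + 1)) := by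
  have hRn : 0 < R ^ n := pow_pos hR n
  have h1 : 8 * R / (k₃ * R ^ n) = 8 / k₃ * (R / R ^ n) := by field_simp
  have h2 : (R ^ n) ^ (q - 1) * R ^ n = (R ^ n) ^ q := by
    rw [Real.rpow_sub_one hRn.ne', div_mul_cancel₀ _ hRn.ne']
  have h3 : R ^ (q * (s + 1)) = (R ^ s) ^ q * (R / R ^ n) ^ q * (R ^ n) ^ q := by
    rw [mul_assoc, ← Real.mul_rpow (by positivity) hRn.le, div_mul_cancel₀ _ hRn.ne',
      ← Real.mul_rpow (by positivity) hR.le, ← Real.rpow_add_one hR.ne', ← Real.rpow_mul hR.le,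
      mul_comm]
  rw [h1, Real.mul_rpow hK₀.le (by positivity), Real.mul_rpow (by positivity) (by positivity),
    Real.mul_rpow hk₁.le hRn.le, h3, ← h2]
  ring

theorem weight_mul_axisWeight_rpow {n : ℕ} {q θ₁ θ₂ a b : ℝ} (hq : 1 < q) {x : En n}
    (hx : 0 < normPrime n x) :
    ENNReal.ofReal (weight n θ₁ θ₂ x) * axisWeight n a b x ^ (q - 1) =
      axisWeight n (θ₁ + a * (q - 1)) (θ₂ + b * (q - 1)) x := by
  have hN : 0 < ‖x‖ := hx.trans_le (normPrime_le_norm x)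
  rw [axisWeight_of_pos hx, axisWeight_of_pos hx,
    ENNReal.ofReal_rpow_of_nonneg (weight_nonneg a b x) (by linarith),
    ← ENNReal.ofReal_mul (weight_nonneg _ _ x)]
  congr 1
  rw [weight, weight, weight, Real.mul_rpow (by positivity) (by positivity),
    ← Real.rpow_mul hx.le, ← Real.rpow_mul hN.le, Real.rpow_add hx, Real.rpow_add hN]
  ring

/-- The isoperimetric inequality when the weight and its dual weight are products of `A₁`
weights and inverse powers of `A₁` weights. -/
theorem weighted_isoperimetric_of_muckenhoupt {n : ℕ} (hn : 2 ≤ n) {q θ1 θ2 : ℝ} (hq : 1 < q)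
    (h₁ : -((n : ℝ) - 1) < θ1) (h₁' : θ1 < ((n : ℝ) - 1) * (q - 1))
    (h₂ : -(n : ℝ) < θ1 + θ2) (h₂' : θ1 + θ2 < (n : ℝ) * (q - 1)) :
    ∃ C : ℝ, 0 < C ∧ ∀ (R : ℝ), 0 < R → ∀ k l : ℝ, k < l → ∀ u : En n → ℝ,
      ContDiff ℝ 1 u →
      ENNReal.ofReal ((l - k) ^ q) *
          (muW n θ1 θ2 {x ∈ ball (0 : En n) R | l ≤ u x}) ^ q *
          muW n θ1 θ2 {x ∈ ball (0 : En n) R | u x ≤ k}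
      ≤ ENNReal.ofReal (C * R ^ (q * ((n : ℝ) + θ1 + θ2 + 1))) *
          ∫⁻ x in {x ∈ ball (0 : En n) R | k < u x ∧ u x < l},
            ENNReal.ofReal (‖gradient u x‖ ^ q) ∂(muW n θ1 θ2) := by
  have hq0 : 0 < q - 1 := by linarith
  have hn2 : (2 : ℝ) ≤ n := by exact_mod_cast hn
  set a := -(max θ1 0 / (q - 1)) with ha
  set b := -(max (θ1 + θ2) 0 / (q - 1)) - a with hb
  have haq : a * (q - 1) = -max θ1 0 := by rw [ha]; field_simp
  have hbq : b * (q - 1) = max θ1 0 - max (θ1 + θ2) 0 := by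
    rw [hb, sub_mul, haq]; field_simp; ring
  have habq : a + b = -(max (θ1 + θ2) 0 / (q - 1)) := by rw [hb]; ring
  have hmin : θ1 + a * (q - 1) = min θ1 0 := by
    rw [haq]; linarith [min_add_max θ1 0]
  have hmin' : θ1 + a * (q - 1) + (θ2 + b * (q - 1)) = min (θ1 + θ2) 0 := by
    rw [haq, hbq]; linarith [min_add_max (θ1 + θ2) 0]
  obtain ⟨Kφ, hKφ, hφ⟩ := exists_lintegral_axisWeight_ball_le hn (a := a) (b := b)
    (by
      rw [ha, neg_lt_neg_iff, div_lt_iff₀ hq0]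
      exact max_lt h₁' (mul_pos (by linarith) hq0))
    (neg_nonpos.2 (div_nonneg (le_max_right _ _) hq0.le))
    (by
      rw [habq, neg_lt_neg_iff, div_lt_iff₀ hq0]
      exact max_lt h₂' (mul_pos (by linarith) hq0))
    (habq.trans_le (neg_nonpos.2 (div_nonneg (le_max_right _ _) hq0.le)))
  obtain ⟨Kψ, hKψ, hψ⟩ := exists_lintegral_axisWeight_ball_le hn
    (a := θ1 + a * (q - 1)) (b := θ2 + b * (q - 1))
    (by rw [hmin]; exact lt_min h₁ (by linarith)) (by rw [hmin]; exact min_le_right _ _)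
    (by rw [hmin']; exact lt_min h₂ (by linarith)) (by rw [hmin']; exact min_le_right _ _)
  obtain ⟨K₀, hK₀, hM⟩ := exists_lintegral_weight_ball_le hn h₁ h₂
  obtain ⟨V, hV, hvol⟩ := exists_volume_ball_eq n
  refine ⟨K₀ ^ q * (8 / V) ^ q * (Kφ * 2 ^ n) ^ (q - 1) * (Kψ * 2 ^ n), by positivity,
    fun R hR k l hkl u hu => ?_⟩
  rw [← isoperimetric_constant_eq hR hK₀ (by positivity) hV]
  refine isoperimetric_of_schur hq hR (w := fun x => ENNReal.ofReal (weight n θ1 θ2 x))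
    (φ := axisWeight n a b) (ψ := axisWeight n (θ1 + a * (q - 1)) (θ2 + b * (q - 1)))
    (measurable_weight n θ1 θ2).ennreal_ofReal (measurable_axisWeight n a b)
    (H := fun _ => ball 0 R) (fun _ => subset_rfl) (fun _ => measurableSet_ball)
    (axisWeight_ne_zero a b) ?_ ?_ (by positivity) (by positivity) ?_ ?_ ?_ (by positivity) ?_
    hu hkl
  · filter_upwards [ae_normPrime_pos hn] with x hx
    rw [axisWeight_of_pos hx]
    exact ENNReal.ofReal_ne_top
  · filter_upwards [ae_normPrime_pos hn] with x hx using weight_mul_axisWeight_rpow hq hx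
  · exact fun x hx => lintegral_segInt_ball_le (measurable_axisWeight n a b) hR hφ hx
  · exact fun f hf => lintegral_mul_segInt_ball_le (measurable_axisWeight n _ _) hR hψ hf
  · intro x _ y _
    rw [inter_self, hvol 0 R hR]
  · rw [withDensity_apply _ measurableSet_ball]
    exact hM R hR

theorem weighted_isoperimetric_of_nonneg_radial {n : ℕ} (hn : 2 ≤ n) {q θ : ℝ} (hq : 1 < q)
    (hθ : 0 ≤ θ) :
    ∃ C : ℝ, 0 < C ∧ ∀ (R : ℝ), 0 < R → ∀ k l : ℝ, k < l → ∀ u : En n → ℝ,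
      ContDiff ℝ 1 u →
      ENNReal.ofReal ((l - k) ^ q) *
          (muW n 0 θ {x ∈ ball (0 : En n) R | l ≤ u x}) ^ q *
          muW n 0 θ {x ∈ ball (0 : En n) R | u x ≤ k}
      ≤ ENNReal.ofReal (C * R ^ (q * ((n : ℝ) + 0 + θ + 1))) *
          ∫⁻ x in {x ∈ ball (0 : En n) R | k < u x ∧ u x < l},
            ENNReal.ofReal (‖gradient u x‖ ^ q) ∂(muW n 0 θ) := by
  have hn2 : (2 : ℝ) ≤ n := by exact_mod_cast hn
  have hweight : ∀ x : En n, weight n 0 θ x = ‖x‖ ^ θ := fun x => by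
    rw [weight, Real.rpow_zero, one_mul]
  obtain ⟨K₀, hK₀, hM⟩ := exists_lintegral_weight_ball_le hn (a := 0) (b := θ) (by linarith)
    (by linarith)
  obtain ⟨V, hV, hvol⟩ := exists_volume_ball_eq n
  refine ⟨K₀ ^ q * (8 / (V / 8 ^ n)) ^ q * V ^ (q - 1) * (4 ^ θ * (V * 2 ^ n)), by positivity,
    fun R hR k l hkl u hu => ?_⟩
  rw [← isoperimetric_constant_eq hR hK₀ hV (by positivity)]
  refine isoperimetric_of_schur hq hR (w := fun x => ENNReal.ofReal (weight n 0 θ x))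
    (φ := fun _ => 1) (ψ := fun x => ENNReal.ofReal (‖x‖ ^ θ))
    (measurable_weight n 0 θ).ennreal_ofReal measurable_const
    (H := outwardSet n R) (fun _ _ hz => hz.1) (measurableSet_outwardSet R)
    (fun _ => one_ne_zero) (ae_of_all _ fun _ => ENNReal.one_ne_top) ?_ (by positivity)
    (by positivity) ?_ ?_ ?_ (by positivity) ?_ hu hkl
  · refine ae_of_all _ fun x => ?_
    rw [ENNReal.one_rpow, mul_one, hweight]
  · intro x _
    calc ∫⁻ z in outwardSet n R x, segInt (fun _ => 1) x z
        ≤ ∫⁻ z in ball (0 : En n) R, segInt (fun _ => 1) x z :=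
          lintegral_mono_set fun z hz => hz.1
      _ = ENNReal.ofReal (V * R ^ n) * 1 := by simp [segInt, hvol 0 R hR]
  · intro f hf
    refine (lintegral_norm_rpow_mul_segInt_outward_le hθ (by positivity) (hvol 0 R hR)
      hf).trans_eq ?_
    congr 2
    ring
  · intro x _ y _
    obtain ⟨e, he, hxe, hye⟩ := exists_norm_eq_one_inner_nonneg hn x y
    calc ENNReal.ofReal (V / 8 ^ n * R ^ n)
        = volume (ball ((3 / 4 * R) • e) (R / 8)) := by
          rw [hvol _ _ (by positivity), div_pow]
          congr 1
          ring
      _ ≤ _ := measure_mono (subset_inter (ball_subset_outwardSet hR he hxe)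
          (ball_subset_outwardSet hR he hye))
  · rw [withDensity_apply _ measurableSet_ball]
    exact hM R hR

/-- weighted isoperimetric inequality of De Giorgi type, first form. -/
theorem weighted_isoperimetric_first (n : ℕ) (hn : 2 ≤ n) (q θ1 θ2 : ℝ) (hq : 1 < q)
    (hθ : (θ1, θ2) ∈ (setA n ∪ setB n) ∩ (setC n q ∪ setD n q) ∨
      (θ1 = 0 ∧ -(n : ℝ) < θ2)) :
    ∃ C : ℝ, 0 < C ∧ ∀ (R : ℝ), 0 < R → ∀ k l : ℝ, k < l → ∀ u : En n → ℝ,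
      ContDiff ℝ 1 u →
      ENNReal.ofReal ((l - k) ^ q) *
          (muW n θ1 θ2 {x ∈ ball (0 : En n) R | l ≤ u x}) ^ q *
          muW n θ1 θ2 {x ∈ ball (0 : En n) R | u x ≤ k}
      ≤ ENNReal.ofReal (C * R ^ (q * ((n : ℝ) + θ1 + θ2 + 1))) *
          ∫⁻ x in {x ∈ ball (0 : En n) R | k < u x ∧ u x < l},
            ENNReal.ofReal (‖gradient u x‖ ^ q) ∂(muW n θ1 θ2) := by
  have hn2 : (2 : ℝ) ≤ n := by exact_mod_cast hn
  have hn1 : 0 < (n : ℝ) - 1 := by linarith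
  have hq0 : 0 < q - 1 := by linarith
  rcases hθ with ⟨hAB, hCD⟩ | ⟨rfl, hθ⟩
  · have h₁ : -((n : ℝ) - 1) < θ1 ∧ -(n : ℝ) < θ1 + θ2 := by
      rcases hAB with ⟨h, h'⟩ | ⟨h, -, h'⟩
      · exact ⟨h, by dsimp only at h h'; linarith⟩
      · exact ⟨h, h'⟩
    have h₂ : θ1 < ((n : ℝ) - 1) * (q - 1) ∧ θ1 + θ2 < n * (q - 1) := by
      rcases hCD with ⟨h, h'⟩ | ⟨h, -, h'⟩
      · exact ⟨h, by dsimp only at h h'; linarith⟩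
      · exact ⟨h, h'⟩
    exact weighted_isoperimetric_of_muckenhoupt hn hq h₁.1 h₂.1 h₁.2 h₂.2
  · rcases le_or_gt 0 θ2 with h | h
    · exact weighted_isoperimetric_of_nonneg_radial hn hq h
    · exact weighted_isoperimetric_of_muckenhoupt hn hq (by linarith) (by positivity)
        (by linarith) (by nlinarith)
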